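/- Let D ⊆ ℂ^l be a domain, let p be a polynomial function on ℂ^l, and let a be a holomorphic function on D \ {z : p(z) = 0} such that p·a extends to a holomorphic function on D. Then for every multi-index I ∈ ℕ₀^l, the function p^{|I|+1} ∂^I a extends to a holomorphic function on D, where ∂^I = (∂/∂z₁)^{ι₁}···(∂/∂z_l)^{ι_l} for I = (ι₁,…,ι_l) and |I| = ι₁ + ··· + ι_l. -/

import Mathlib

noncomputable section

/-- The partial derivative `∂/∂z_j` of a function on `ℂ^l`. -/
def pderiv' {l : ℕ} (j : Fin l) (f : (Fin l → ℂ) → ℂ) : (Fin l → ℂ) → ℂ :=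
  fun z => deriv (fun t : ℂ => f (Function.update z j t)) (z j)

/-- The iterated partial derivative `∂^I = (∂/∂z₁)^{ι₁} ⋯ (∂/∂z_l)^{ι_l}`. -/
def pderivI {l : ℕ} (I : Fin l → ℕ) (f : (Fin l → ℂ) → ℂ) : (Fin l → ℂ) → ℂ :=
  (List.finRange l).foldr (fun j g => (pderiv' j)^[I j] g) f

/-- A directional derivative of a holomorphic function on an open subset of a finite-dimensional
complex space is holomorphic. -/
theorem differentiableOn_fderiv_apply_of_isOpen {E : Type*} [NormedAddCommGroup E]
    [NormedSpace ℂ E] [FiniteDimensional ℂ E] {f : E → ℂ} {D : Set E}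
    (hf : DifferentiableOn ℂ f D) (hD : IsOpen D) (v : E) :
    DifferentiableOn ℂ (fun z => fderiv ℂ f z v) D := by
  intro z₀ hz₀
  refine DifferentiableAt.differentiableWithinAt ?_
  borelize E
  have : ProperSpace E := FiniteDimensional.proper ℂ E
  have : ProperSpace (E →L[ℂ] ℂ) := FiniteDimensional.proper ℂ _
  -- On a ball of radius `4 * r` the function stays within distance one of its central value.
  obtain ⟨r, hr, hrD, hr1⟩ : ∃ r > 0, Metric.ball z₀ (4 * r) ⊆ D ∧
      ∀ z ∈ Metric.ball z₀ (4 * r), dist (f z) (f z₀) < 1 := by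
    have h1 : ∀ᶠ z in nhds z₀, z ∈ D ∧ dist (f z) (f z₀) < 1 :=
      (hD.eventually_mem hz₀).and
        ((hf.continuousOn.continuousAt (hD.mem_nhds hz₀)).eventually
          (Metric.ball_mem_nhds _ one_pos))
    obtain ⟨ε, hε, h⟩ := Metric.eventually_nhds_iff_ball.1 h1
    refine ⟨ε / 4, by positivity, ?_⟩
    rw [mul_div_cancel₀ _ (by norm_num : (4 : ℝ) ≠ 0)]
    exact ⟨fun z hz => (h z hz).1, fun z hz => (h z hz).2⟩
  have hdiff : ∀ z ∈ Metric.ball z₀ (4 * r), DifferentiableAt ℂ f z := fun z hz =>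
    hf.differentiableAt (hD.mem_nhds (hrD hz))
  have hbound : ∀ z ∈ Metric.ball z₀ (2 * r), ‖fderiv ℂ f z‖ ≤ 2 / r := by
    intro z hz
    have hsub : Metric.ball z r ⊆ Metric.ball z₀ (4 * r) :=
      Metric.ball_subset_ball' (by rw [Metric.mem_ball] at hz; linarith)
    refine Complex.norm_fderiv_le_div_of_mapsTo_ball
      (fun w hw => (hdiff w (hsub hw)).differentiableWithinAt) (fun w hw => ?_) hr
    have h1 := hr1 w (hsub hw)
    have h2 := hr1 z (hsub (Metric.mem_ball_self hr))
    rw [Metric.mem_closedBall]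
    linarith [dist_triangle_right (f w) (f z) (f z₀)]
  set ρ : ℝ := r / (‖v‖ + 1) with hρ_def
  have hρ : 0 < ρ := by positivity
  have hρv : ρ * ‖v‖ < r := by
    rw [hρ_def, div_mul_eq_mul_div, div_lt_iff₀ (by positivity)]
    nlinarith
  have hmem : ∀ z ∈ Metric.ball z₀ r, ∀ t ∈ Metric.closedBall (0 : ℂ) ρ,
      z + t • v ∈ Metric.ball z₀ (2 * r) := by
    intro z hz t ht
    rw [Metric.mem_ball, dist_eq_norm] at hz ⊢
    rw [mem_closedBall_zero_iff] at ht
    calc ‖z + t • v - z₀‖ = ‖(z - z₀) + t • v‖ := by congr 1; abel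
      _ ≤ ‖z - z₀‖ + ‖t‖ * ‖v‖ := (norm_add_le _ _).trans_eq (by rw [norm_smul])
      _ ≤ ‖z - z₀‖ + ρ * ‖v‖ := by gcongr
      _ < 2 * r := by linarith
  have hball : Metric.ball z₀ (2 * r) ⊆ Metric.ball z₀ (4 * r) :=
    Metric.ball_subset_ball (by linarith)
  have hcircle : ∀ θ, circleMap 0 ρ θ ∈ Metric.closedBall (0 : ℂ) ρ :=
    circleMap_mem_closedBall 0 hρ.le
  set k : ℝ → ℂ := fun θ => deriv (circleMap 0 ρ) θ * (1 / (circleMap 0 ρ θ - 0) ^ 2) with hk_def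
  have hk : Continuous k := by
    have h0 : ∀ θ, (circleMap 0 ρ θ - 0) ^ 2 ≠ 0 := fun θ => by
      simpa using hρ.ne'
    simp only [hk_def, deriv_circleMap]
    exact ((continuous_circleMap 0 ρ).mul continuous_const).mul
      (continuous_const.div (by fun_prop) h0)
  -- The Cauchy formula for the directional derivative.
  have hcauchy : ∀ z ∈ Metric.ball z₀ r, fderiv ℂ f z v =
      (2 * Real.pi * Complex.I)⁻¹ *
        ∫ θ in Set.Ioc 0 (2 * Real.pi), k θ * f (z + circleMap 0 ρ θ • v) := by
    intro z hz
    have hline : ∀ t ∈ Metric.closedBall (0 : ℂ) ρ,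
        HasDerivAt (fun t : ℂ => f (z + t • v)) (fderiv ℂ f (z + t • v) v) t := by
      intro t ht
      have h1 : HasDerivAt (fun t : ℂ => z + t • v) v t := by
        simpa using ((hasDerivAt_id t).smul_const v).const_add z
      exact (hdiff _ (hball (hmem z hz t ht))).hasFDerivAt.comp_hasDerivAt t h1
    have h := DifferentiableOn.deriv_eq_smul_circleIntegral hρ
      (fun t ht => (hline t ht).differentiableAt.differentiableWithinAt)
    have h0 := (hline 0 (Metric.mem_closedBall_self hρ.le)).deriv
    rw [zero_smul, add_zero] at h0
    rw [h0, circleIntegral, intervalIntegral.integral_of_le Real.two_pi_pos.le] at h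
    rw [eq_inv_mul_iff_mul_eq₀ Complex.two_pi_I_ne_zero, ← smul_eq_mul, ← h]
    simp only [hk_def, smul_eq_mul, mul_assoc]
  have hFcont : ∀ z ∈ Metric.ball z₀ r, Continuous fun θ => k θ * f (z + circleMap 0 ρ θ • v) := by
    intro z hz
    refine hk.mul (continuous_iff_continuousAt.2 fun θ => ?_)
    refine ContinuousAt.comp' (hdiff _ (hball (hmem z hz _ (hcircle θ)))).continuousAt ?_
    fun_prop
  have hint := hasFDerivAt_integral_of_dominated_of_fderiv_le (𝕜 := ℂ)
    (μ := MeasureTheory.volume.restrict (Set.Ioc 0 (2 * Real.pi)))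
    (F := fun z θ => k θ * f (z + circleMap 0 ρ θ • v))
    (F' := fun z θ => k θ • fderiv ℂ f (z + circleMap 0 ρ θ • v))
    (bound := fun θ => ‖k θ‖ * (2 / r))
    (Metric.ball_mem_nhds z₀ hr)
    (Filter.eventually_of_mem (Metric.ball_mem_nhds z₀ hr)
      fun z hz => (hFcont z hz).aestronglyMeasurable)
    ((hFcont z₀ (Metric.mem_ball_self hr)).integrableOn_Ioc)
    (by
      refine MeasureTheory.AEStronglyMeasurable.smul hk.aestronglyMeasurable ?_
      refine Measurable.aestronglyMeasurable ?_
      exact (measurable_fderiv ℂ f).comp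
        (Continuous.measurable (by fun_prop)))
    (Filter.Eventually.of_forall fun θ z hz => by
      rw [norm_smul]
      gcongr
      exact hbound _ (hmem z hz _ (hcircle θ)))
    (Continuous.integrableOn_Ioc (by fun_prop))
    (Filter.Eventually.of_forall fun θ z hz =>
      ((hdiff _ (hball (hmem z hz _ (hcircle θ)))).hasFDerivAt.comp z
        ((hasFDerivAt_id z).add_const (circleMap 0 ρ θ • v))).const_mul (k θ))
  refine (hint.differentiableAt.const_mul (2 * Real.pi * Complex.I)⁻¹).congr_of_eventuallyEq ?_
  exact Filter.eventually_of_mem (Metric.ball_mem_nhds z₀ hr) hcauchy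

theorem pderiv'_eq_fderiv {l : ℕ} (j : Fin l) {f : (Fin l → ℂ) → ℂ} {z : Fin l → ℂ}
    (hf : DifferentiableAt ℂ f z) : pderiv' j f z = fderiv ℂ f z (Pi.single j 1) := by
  have h := hasDerivAt_update z j (z j)
  have hf' : HasFDerivAt f (fderiv ℂ f z) (Function.update z j (z j)) := by
    rw [Function.update_eq_self]
    exact hf.hasFDerivAt
  exact (hf'.comp_hasDerivAt (z j) h).deriv

theorem MvPolynomial.differentiable_eval {σ : Type*} [Fintype σ] (p : MvPolynomial σ ℂ) :
    Differentiable ℂ fun z : σ → ℂ => MvPolynomial.eval z p := by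
  induction p using MvPolynomial.induction_on with
  | C c => simp
  | add p q hp hq =>
    simp only [map_add]
    exact hp.add hq
  | mul_X p i hp =>
    simp only [map_mul, MvPolynomial.eval_X]
    exact hp.mul (differentiable_apply i)

/-- `g` is holomorphic on `D` off the zeros of `p`, and `p ^ (n + 1) * g` extends
holomorphically to `D`. -/
def HasPoleOrderLE {l : ℕ} (D : Set (Fin l → ℂ)) (p : MvPolynomial (Fin l) ℂ) (n : ℕ)
    (g : (Fin l → ℂ) → ℂ) : Prop :=
  DifferentiableOn ℂ g (D \ {z | MvPolynomial.eval z p = 0}) ∧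
    ∃ c : (Fin l → ℂ) → ℂ, DifferentiableOn ℂ c D ∧
      ∀ z ∈ D, MvPolynomial.eval z p ≠ 0 → c z = MvPolynomial.eval z p ^ (n + 1) * g z

namespace HasPoleOrderLE

variable {l : ℕ} {D : Set (Fin l → ℂ)} {p : MvPolynomial (Fin l) ℂ} {n : ℕ}
  {g : (Fin l → ℂ) → ℂ}

theorem pderiv' (hD : IsOpen D) (j : Fin l) (h : HasPoleOrderLE D p n g) :
    HasPoleOrderLE D p (n + 1) (pderiv' j g) := by
  obtain ⟨hg, c, hc, hcg⟩ := h
  set v : Fin l → ℂ := Pi.single j 1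
  have hp := p.differentiable_eval
  have hU : IsOpen (D \ {z | MvPolynomial.eval z p = 0}) :=
    hD.sdiff (isClosed_eq hp.continuous continuous_const)
  have hgz : ∀ z ∈ D \ {z | MvPolynomial.eval z p = 0}, DifferentiableAt ℂ g z := fun z hz =>
    hg.differentiableAt (hU.mem_nhds hz)
  refine ⟨(differentiableOn_fderiv_apply_of_isOpen hg hU v).congr fun z hz => pderiv'_eq_fderiv j (hgz z hz),
    fun z => MvPolynomial.eval z p * fderiv ℂ c z v -
      (n + 1) * fderiv ℂ (fun z => MvPolynomial.eval z p) z v * c z, ?_, ?_⟩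
  · have hp' : DifferentiableOn ℂ (fun z => fderiv ℂ (fun z => MvPolynomial.eval z p) z v) D :=
      (differentiableOn_fderiv_apply_of_isOpen hp.differentiableOn isOpen_univ v).mono
        (Set.subset_univ D)
    exact (hp.differentiableOn.mul (differentiableOn_fderiv_apply_of_isOpen hc hD v)).sub
      ((hp'.const_mul _).mul hc)
  · intro z hz hpz
    have hzU : z ∈ D \ {z | MvPolynomial.eval z p = 0} := ⟨hz, hpz⟩
    have hEq : c =ᶠ[nhds z] fun w => MvPolynomial.eval w p ^ (n + 1) * g w :=
      Filter.eventually_of_mem (hU.mem_nhds hzU) fun w hw => hcg w hw.1 hw.2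
    have hder := ((hp z).hasFDerivAt.pow (n + 1)).mul (hgz z hzU).hasFDerivAt
    beta_reduce
    rw [pderiv'_eq_fderiv j (hgz z hzU), hcg z hz hpz, (hder.congr_of_eventuallyEq hEq).fderiv]
    simp
    ring

theorem iterate_pderiv' (hD : IsOpen D) (j : Fin l) (h : HasPoleOrderLE D p n g) (m : ℕ) :
    HasPoleOrderLE D p (n + m) ((_root_.pderiv' j)^[m] g) := by
  induction m with
  | zero => exact h
  | succ m ih =>
    rw [Function.iterate_succ_apply']
    exact ih.pderiv' hD j

theorem foldr_pderiv' (hD : IsOpen D) (I : Fin l → ℕ) (h : HasPoleOrderLE D p n g)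
    (L : List (Fin l)) :
    HasPoleOrderLE D p (n + (L.map I).sum)
      (L.foldr (fun j g => (_root_.pderiv' j)^[I j] g) g) := by
  induction L with
  | nil => exact h
  | cons j L ih =>
    rw [List.foldr_cons, List.map_cons, List.sum_cons, add_comm (I j), ← add_assoc]
    exact ih.iterate_pderiv' hD j (I j)

end HasPoleOrderLE

/-- Let `D ⊆ ℂ^l` be a domain, `p` a polynomial on `ℂ^l`, and `a`
holomorphic on `D \ {p = 0}` such that `p·a` extends to a holomorphic function `b` on
`D`.  Then for every multi-index `I`, the function `p^{|I|+1} ∂^I a` extends to a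
holomorphic function on `D`. -/
theorem pow_mul_iterated_deriv_extends_holomorphic
    {l : ℕ} (D : Set (Fin l → ℂ)) (hD : IsOpen D) (hDconn : IsConnected D)
    (p : MvPolynomial (Fin l) ℂ) (a b : (Fin l → ℂ) → ℂ)
    (ha : DifferentiableOn ℂ a (D \ {z | MvPolynomial.eval z p = 0}))
    (hb : DifferentiableOn ℂ b D)
    (hab : ∀ z ∈ D, MvPolynomial.eval z p ≠ 0 → b z = MvPolynomial.eval z p * a z) :
    ∀ I : Fin l → ℕ, ∃ c : (Fin l → ℂ) → ℂ, DifferentiableOn ℂ c D ∧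
      ∀ z ∈ D, MvPolynomial.eval z p ≠ 0 →
        c z = MvPolynomial.eval z p ^ ((∑ j, I j) + 1) * pderivI I a z := by
  intro I
  have h : HasPoleOrderLE D p 0 a := ⟨ha, b, hb, by simpa using hab⟩
  have hI := (h.foldr_pderiv' hD I (List.finRange l)).2
  rwa [zero_add, ← Fin.sum_univ_def] at hI

end
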